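/- Let L be the centerless N=2 superconformal Neveu-Schwarz algebra and r ∈ L⊗L. If x ∗ r ∈ Im(1 − τ) for all x ∈ L, then r ∈ Im(1 − τ). -/

import Mathlib

noncomputable section
open Finsupp

/-- Sign `(-1)^(a*b)` for parities `a b : ZMod 2`. -/
def sg (a b : ZMod 2) : ℂ := if a * b = 1 then -1 else 1

/-- A (basis-presented) superalgebra datum: a basis `ι`, a parity function and
structure "constants" giving the bracket of two basis elements. -/
structure SuperData where
  ι : Type
  par : ι → ZMod 2
  br : ι → ι → (ι →₀ ℂ)

namespace SuperData

variable (D : SuperData)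

/-- The underlying vector space, with basis `ι`. -/
abbrev V := D.ι →₀ ℂ

/-- The tensor square `V ⊗ V`, modelled on the basis `ι × ι`. -/
abbrev T2 := (D.ι × D.ι) →₀ ℂ

/-- The tensor cube `V ⊗ V ⊗ V`. -/
abbrev T3 := (D.ι × D.ι × D.ι) →₀ ℂ

/-- The `n`-fold tensor power. -/
abbrev Tn (n : ℕ) := ((Fin n → D.ι) →₀ ℂ)

/-- Basis vectors. -/
def e (i : D.ι) : D.V := Finsupp.single i 1

/-- Linear extension of a map defined on the basis. -/
def lift {α : Type*} {M : Type*} [AddCommGroup M] [Module ℂ M] (g : α → M) :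
    (α →₀ ℂ) →ₗ[ℂ] M :=
  Finsupp.linearCombination ℂ g

/-- The bilinear bracket extending `D.br`. -/
def brk : D.V →ₗ[ℂ] D.V →ₗ[ℂ] D.V :=
  lift fun i => lift fun j => D.br i j

/-- Bilinear tensor-product map `V × V → V ⊗ V`. -/
def tens2 : D.V →ₗ[ℂ] D.V →ₗ[ℂ] D.T2 :=
  lift fun i => lift fun j => Finsupp.single (i, j) 1

/-- Trilinear tensor-product map. -/
def tens3 : D.V →ₗ[ℂ] D.V →ₗ[ℂ] D.V →ₗ[ℂ] D.T3 :=
  lift fun i => lift fun j => lift fun k => Finsupp.single (i, j, k) 1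

/-- The super-twist map `τ(x ⊗ y) = (-1)^{|x||y|} y ⊗ x`. -/
def tau : D.T2 →ₗ[ℂ] D.T2 :=
  lift fun p => sg (D.par p.1) (D.par p.2) • Finsupp.single (p.2, p.1) 1

/-- The super-cyclic map `ξ = (1⊗τ)(τ⊗1)` on the tensor cube. -/
def xi : D.T3 →ₗ[ℂ] D.T3 :=
  lift fun p => sg (D.par p.1) (D.par p.2.1 + D.par p.2.2) •
    Finsupp.single (p.2.1, p.2.2, p.1) 1

/-- The adjoint diagonal action of `V` on `V ⊗ V`:
`x ∗ (a⊗b) = [x,a]⊗b + (-1)^{|x||a|} a⊗[x,b]`. -/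
def star2 : D.V →ₗ[ℂ] D.T2 →ₗ[ℂ] D.T2 :=
  lift fun k => lift fun p =>
    D.tens2 (D.br k p.1) (D.e p.2) +
      sg (D.par k) (D.par p.1) • D.tens2 (D.e p.1) (D.br k p.2)

/-- The adjoint diagonal action of `V` on `V ⊗ V ⊗ V`. -/
def star3 : D.V →ₗ[ℂ] D.T3 →ₗ[ℂ] D.T3 :=
  lift fun k => lift fun p =>
    D.tens3 (D.br k p.1) (D.e p.2.1) (D.e p.2.2) +
      sg (D.par k) (D.par p.1) • D.tens3 (D.e p.1) (D.br k p.2.1) (D.e p.2.2) +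
      sg (D.par k) (D.par p.1 + D.par p.2.1) •
        D.tens3 (D.e p.1) (D.e p.2.1) (D.br k p.2.2)

/-- The adjoint diagonal action of `V` on the `n`-fold tensor power, with Koszul signs. -/
def starN (n : ℕ) : D.V →ₗ[ℂ] D.Tn n →ₗ[ℂ] D.Tn n :=
  lift fun k => lift fun f =>
    ∑ i : Fin n, sg (D.par k) (∑ j ∈ Finset.Iio i, D.par (f j)) •
      Finsupp.mapDomain (Function.update f i) (D.br k (f i))

/-- `c(r) = [r¹²,r¹³] + [r¹²,r²³] + [r¹³,r²³]`, the Yang–Baxter expression. -/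
def cybe (r : D.T2) : D.T3 :=
  r.sum fun p a => r.sum fun q b => (a * b) •
    (sg (D.par q.1) (D.par p.2) •
        (D.tens3 (D.br p.1 q.1) (D.e p.2) (D.e q.2) +
          D.tens3 (D.e p.1) (D.e q.1) (D.br p.2 q.2)) +
      D.tens3 (D.e p.1) (D.br p.2 q.1) (D.e q.2))

/-- The image of `1 - τ` in `V ⊗ V`. -/
def ImSkew : Submodule ℂ D.T2 := LinearMap.range (LinearMap.id - D.tau)

/-- `x` is homogeneous of parity `dp`. -/
def Homog1 (dp : ZMod 2) (x : D.V) : Prop := ∀ i ∈ x.support, D.par i = dp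

/-- `t ∈ V ⊗ V` is homogeneous of parity `dp`. -/
def Homog2 (dp : ZMod 2) (t : D.T2) : Prop :=
  ∀ p ∈ t.support, D.par p.1 + D.par p.2 = dp

/-- `t ∈ V ⊗ V` is even. -/
def IsEven2 (t : D.T2) : Prop := D.Homog2 0 t

/-- Super skew-symmetry of the bracket (on homogeneous elements). -/
def SuperSkew : Prop :=
  ∀ (px py : ZMod 2) (x y : D.V), D.Homog1 px x → D.Homog1 py y →
    D.brk x y = -sg px py • D.brk y x

/-- The graded Jacobi identity
`(-1)^{|x||z|}[x,[y,z]] + (-1)^{|y||x|}[y,[z,x]] + (-1)^{|z||y|}[z,[x,y]] = 0`. -/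
def SuperJacobi : Prop :=
  ∀ (px py pz : ZMod 2) (x y z : D.V), D.Homog1 px x → D.Homog1 py y → D.Homog1 pz z →
    sg px pz • D.brk x (D.brk y z) + sg py px • D.brk y (D.brk z x) +
      sg pz py • D.brk z (D.brk x y) = 0

/-- `D` presents a Lie superalgebra. -/
def IsLieSuper : Prop := D.SuperSkew ∧ D.SuperJacobi

/-- `f : V → V ⊗ V` is a homogeneous derivation of parity `dp`. -/
def IsDer2 (dp : ZMod 2) (f : D.V →ₗ[ℂ] D.T2) : Prop :=
  ∀ i j, f (D.br i j) =
    sg dp (D.par i) • D.star2 (D.e i) (f (D.e j)) -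
      sg (D.par j) (dp + D.par i) • D.star2 (D.e j) (f (D.e i))

/-- `f : V → V` is a homogeneous derivation of parity `dp` (adjoint coefficients). -/
def IsDerV (dp : ZMod 2) (f : D.V →ₗ[ℂ] D.V) : Prop :=
  ∀ i j, f (D.br i j) =
    sg dp (D.par i) • D.brk (D.e i) (f (D.e j)) -
      sg (D.par j) (dp + D.par i) • D.brk (D.e j) (f (D.e i))

/-- `(1 ⊗ Δ)` as a map `V⊗V → V⊗V⊗V`, for `Δ : V → V⊗V`. -/
def oneDelta (Δf : D.V →ₗ[ℂ] D.T2) : D.T2 →ₗ[ℂ] D.T3 :=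
  lift fun p => Finsupp.mapDomain (fun q : D.ι × D.ι => (p.1, q.1, q.2)) (Δf (D.e p.2))

/-- `Δf` makes `D` into a Lie superbialgebra: `Δf` respects the `ℤ₂`-grading, has image
in `Im(1-τ)`, satisfies co-Jacobi, and is compatible with the bracket via the
adjoint diagonal action. -/
def IsSBialg (Δf : D.V →ₗ[ℂ] D.T2) : Prop :=
  (∀ (dp : ZMod 2) (x : D.V), D.Homog1 dp x → D.Homog2 dp (Δf x)) ∧
  (∀ x : D.V, Δf x ∈ D.ImSkew) ∧
  (∀ x : D.V, D.oneDelta Δf (Δf x) + D.xi (D.oneDelta Δf (Δf x)) +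
      D.xi (D.xi (D.oneDelta Δf (Δf x))) = 0) ∧
  (∀ i j, Δf (D.br i j) =
    D.star2 (D.e i) (Δf (D.e j)) - sg (D.par i) (D.par j) • D.star2 (D.e j) (Δf (D.e i)))

end SuperData

open SuperData

/-- Basis of the centerless `N=2` superconformal Neveu–Schwarz algebra:
`L m`, `I m` for `m : ℤ`, and `G s k` denoting `G_{k+1/2}^±` (`s = true` for `+`). -/
inductive NSI : Type
  | L : ℤ → NSI
  | I : ℤ → NSI
  | G : Bool → ℤ → NSI
  deriving DecidableEq

/-- Structure constants of the centerless `N=2` Neveu–Schwarz algebra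
(`G s k` stands for `G^±_r` with `r = k + 1/2`). -/
def nsBr : NSI → NSI → (NSI →₀ ℂ)
  | .L m, .L n => ((m : ℂ) - n) • Finsupp.single (.L (m + n)) 1
  | .L m, .I n => (-(n : ℂ)) • Finsupp.single (.I (m + n)) 1
  | .I m, .L n => (m : ℂ) • Finsupp.single (.I (m + n)) 1
  | .I _, .I _ => 0
  | .L m, .G s k => (((m : ℂ) - 2 * k - 1) / 2) • Finsupp.single (.G s (m + k)) 1
  | .G s k, .L m => (-(((m : ℂ) - 2 * k - 1) / 2)) • Finsupp.single (.G s (m + k)) 1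
  | .I m, .G s k => (if s then (1 : ℂ) else -1) • Finsupp.single (.G s (m + k)) 1
  | .G s k, .I m => (if s then (-1 : ℂ) else 1) • Finsupp.single (.G s (m + k)) 1
  | .G true k, .G false l =>
      (2 : ℂ) • Finsupp.single (.L (k + l + 1)) 1 +
        ((k : ℂ) - l) • Finsupp.single (.I (k + l + 1)) 1
  | .G false k, .G true l =>
      (2 : ℂ) • Finsupp.single (.L (k + l + 1)) 1 +
        ((l : ℂ) - k) • Finsupp.single (.I (k + l + 1)) 1
  | .G true _, .G true _ => 0
  | .G false _, .G false _ => 0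

/-- Parity on the Neveu–Schwarz basis. -/
def nsPar : NSI → ZMod 2
  | .G _ _ => 1
  | _ => 0

/-- The centerless `N=2` superconformal Neveu–Schwarz algebra. -/
def NSd : SuperData := ⟨NSI, nsPar, nsBr⟩

/-- Twice the `½ℤ`-degree: `deg L_m = deg I_m = -m`, `deg G_r^± = -r`. -/
def deg2 : NSI → ℤ
  | .L m => -(2 * m)
  | .I m => -(2 * m)
  | .G _ k => -(2 * k + 1)

theorem sg_mul_self (a b : ZMod 2) : sg a b * sg a b = 1 := by
  unfold sg; split_ifs <;> simp

theorem sg_comm (a b : ZMod 2) : sg a b = sg b a := by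
  simp [sg, mul_comm]

theorem sg_add_left (a b c : ZMod 2) : sg (a + b) c = sg a c * sg b c := by
  have key : ∀ a b c : ZMod 2, ((a + b) * c = 1 ↔ ¬ (a * c = 1 ↔ b * c = 1)) := by decide
  have h := key a b c
  unfold sg
  by_cases h1 : a * c = 1 <;> by_cases h2 : b * c = 1 <;> simp [h, h1, h2]

namespace SuperData

theorem lift_single {α : Type*} {M : Type*} [AddCommGroup M] [Module ℂ M] (g : α → M)
    (a : α) (c : ℂ) : lift g (Finsupp.single a c) = c • g a := by
  simp [lift]

variable (D : SuperData)

theorem tau_single (p : D.ι × D.ι) (c : ℂ) :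
    D.tau (Finsupp.single p c) =
      c • sg (D.par p.1) (D.par p.2) • Finsupp.single (p.2, p.1) 1 :=
  lift_single _ _ _

theorem tens2_single (i j : D.ι) (c d : ℂ) :
    D.tens2 (Finsupp.single i c) (Finsupp.single j d) = (c * d) • Finsupp.single (i, j) 1 := by
  simp [tens2, lift_single, mul_smul]

theorem star2_e_single (k : D.ι) (p : D.ι × D.ι) (c : ℂ) :
    D.star2 (D.e k) (Finsupp.single p c) =
      c • (D.tens2 (D.br k p.1) (D.e p.2) +
        sg (D.par k) (D.par p.1) • D.tens2 (D.e p.1) (D.br k p.2)) := by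
  simp only [star2, e, lift_single, one_smul]

theorem tau_tau (t : D.T2) : D.tau (D.tau t) = t := by
  induction t using Finsupp.induction_linear with
  | zero => simp
  | add f g hf hg => simp [hf, hg]
  | single p c =>
    rw [tau_single, map_smul, map_smul, tau_single, one_smul, sg_comm (D.par p.2),
      smul_smul (sg _ _), sg_mul_self, one_smul, Finsupp.smul_single_one]

theorem mem_ImSkew_iff (t : D.T2) : t ∈ D.ImSkew ↔ t + D.tau t = 0 := by
  constructor
  · rintro ⟨u, rfl⟩
    simp [tau_tau]
  · intro h
    refine ⟨(1 / 2 : ℂ) • t, ?_⟩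
    have h' : D.tau t = -t := (neg_eq_of_add_eq_zero_right h).symm
    simp only [LinearMap.sub_apply, LinearMap.id_apply, map_smul, h']
    module

theorem tau_tens2_e_right (j : D.ι) (q : ZMod 2) (v : D.V) (hv : D.Homog1 q v) :
    D.tau (D.tens2 v (D.e j)) = sg q (D.par j) • D.tens2 (D.e j) v := by
  conv_lhs => rw [← Finsupp.sum_single v]
  conv_rhs => rw [← Finsupp.sum_single v]
  simp only [Finsupp.sum, map_sum, LinearMap.sum_apply, Finset.smul_sum]
  refine Finset.sum_congr rfl fun i hi => ?_
  simp only [e, tens2_single, map_smul, tau_single, hv i hi, one_smul, mul_one, one_mul]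
  exact smul_comm _ _ _

theorem tau_tens2_e_left (j : D.ι) (q : ZMod 2) (v : D.V) (hv : D.Homog1 q v) :
    D.tau (D.tens2 (D.e j) v) = sg q (D.par j) • D.tens2 v (D.e j) := by
  have h := congrArg D.tau (D.tau_tens2_e_right j q v hv)
  rw [tau_tau, map_smul] at h
  rw [h, smul_smul, sg_mul_self, one_smul]

/-- When the bracket is even, the diagonal action commutes with the super-twist. -/
theorem tau_star2_e (hD : ∀ i j, D.Homog1 (D.par i + D.par j) (D.br i j)) (k : D.ι) (t : D.T2) :
    D.tau (D.star2 (D.e k) t) = D.star2 (D.e k) (D.tau t) := by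
  induction t using Finsupp.induction_linear with
  | zero => simp
  | add f g hf hg => simp [hf, hg]
  | single p c =>
    simp only [star2_e_single, tau_single, map_smul, map_add, one_smul,
      D.tau_tens2_e_right _ _ _ (hD k p.1), D.tau_tens2_e_left _ _ _ (hD k p.2),
      sg_add_left, smul_add, smul_smul]
    rw [add_comm]
    have h := sg_mul_self (D.par k) (D.par p.1)
    congr 2
    · rw [sg_comm (D.par p.2)]
      linear_combination c * sg (D.par p.1) (D.par p.2) * h
    · ring

theorem tau_apply (t : D.T2) (a b : D.ι) :
    D.tau t (a, b) = sg (D.par a) (D.par b) * t (b, a) := by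
  classical
  induction t using Finsupp.induction_linear with
  | zero => simp
  | add f g hf hg => simp only [map_add, Finsupp.add_apply, hf, hg, mul_add]
  | single p c =>
    obtain ⟨x, y⟩ := p
    simp only [tau_single, Finsupp.smul_apply, smul_eq_mul, Finsupp.single_apply, Prod.mk.injEq]
    by_cases h : y = a ∧ x = b
    · obtain ⟨rfl, rfl⟩ := h
      simp [sg_comm, mul_comm]
    · rw [if_neg h, if_neg fun h' => h h'.symm]
      simp

/-- Coefficients of `k ∗ t` when the even basis vector `k` acts by a weighted permutation of the
basis. -/
theorem star2_e_apply {k : D.ι} (hk : D.par k = 0) (f : D.ι ≃ D.ι) (w : D.ι → ℂ)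
    (hbr : ∀ a, D.br k a = Finsupp.single (f a) (w a)) (t : D.T2) (a b : D.ι) :
    D.star2 (D.e k) t (f a, b) = w a * t (a, b) + w (f.symm b) * t (f a, f.symm b) := by
  classical
  induction t using Finsupp.induction_linear with
  | zero => simp
  | add g h hg hh =>
    simp only [map_add, Finsupp.add_apply, hg, hh]
    ring
  | single p c =>
    obtain ⟨x, y⟩ := p
    have hsg : sg (D.par k) (D.par x) = 1 := by simp [sg, hk]
    rw [star2_e_single]
    simp only [hsg, hbr, e, tens2_single, one_smul, mul_one, one_mul,
      Finsupp.smul_apply, Finsupp.add_apply, smul_eq_mul, Finsupp.single_apply, Prod.mk.injEq,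
      f.injective.eq_iff, f.eq_symm_apply]
    by_cases h1 : x = a ∧ y = b <;> by_cases h2 : x = f a ∧ f y = b
    · obtain ⟨rfl, rfl⟩ := h1
      obtain ⟨h2, h3⟩ := h2
      have h4 : f.symm y = y := f.symm_apply_eq.2 h3.symm
      simp only [← h2, h3, h4, and_self, if_true]
      ring
    · obtain ⟨rfl, rfl⟩ := h1
      simp [h2, mul_comm]
    · obtain ⟨rfl, rfl⟩ := h2
      simp [h1, mul_comm]
    · simp [h1, h2]

theorem star2_e_single_diag_apply {k i j : D.ι} (hij : i ≠ j) {d : ℂ}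
    (hbr : D.br k i = Finsupp.single j d) (c : ℂ) :
    D.star2 (D.e k) (Finsupp.single (i, i) c) (j, i) = c * d := by
  rw [star2_e_single, hbr]
  simp [e, tens2_single, hij]

end SuperData

theorem nsPar_eq_of_nsBr_apply_ne_zero {i j x : NSI} (hx : nsBr i j x ≠ 0) :
    nsPar x = nsPar i + nsPar j := by
  have h2 : (1 + 1 : ZMod 2) = 0 := by decide
  rcases i with m | m | ⟨_ | _, m⟩ <;> rcases j with n | n | ⟨_ | _, n⟩ <;>
    rcases x with l | l | ⟨s, l⟩ <;>
    simp [nsBr, nsPar, h2, Finsupp.single_apply] at hx ⊢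

theorem nsBr_homog (i j : NSd.ι) : NSd.Homog1 (NSd.par i + NSd.par j) (NSd.br i j) :=
  fun _ hx => nsPar_eq_of_nsBr_apply_ne_zero (Finsupp.mem_support_iff.1 hx)

namespace NSI

/-- Translation of the mode number. -/
def shift (m : ℤ) : NSI ≃ NSI where
  toFun
    | .L n => .L (m + n)
    | .I n => .I (m + n)
    | .G s k => .G s (m + k)
  invFun
    | .L n => .L (-m + n)
    | .I n => .I (-m + n)
    | .G s k => .G s (-m + k)
  left_inv a := by cases a <;> simp
  right_inv a := by cases a <;> simp

/-- The weight `w` in `[L_m, a] = w • a.shift m`. -/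
def weight (m : ℤ) : NSI → ℂ
  | .L n => (m : ℂ) - n
  | .I n => -(n : ℂ)
  | .G _ k => ((m : ℂ) - 2 * k - 1) / 2

theorem nsBr_L (m : ℤ) (a : NSI) :
    nsBr (.L m) a = Finsupp.single (shift m a) (weight m a) := by
  rw [← Finsupp.smul_single_one]
  cases a <;> rfl

theorem shift_left_injective (a : NSI) : Function.Injective fun m : ℤ => shift m a := by
  intro m n h
  cases a <;> simpa [shift] using h

theorem finite_weight_eq_zero {a : NSI} (ha : a ≠ .I 0) : {m : ℤ | weight m a = 0}.Finite := by
  apply Set.Subsingleton.finite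
  intro m (hm : weight m a = 0) n (hn : weight n a = 0)
  rcases a with k | k | ⟨s, k⟩
  · exact_mod_cast (sub_left_inj.1 (hm.trans hn.symm) : (m : ℂ) = n)
  · exact absurd (by simpa [weight] using hm) (fun h : k = 0 => ha (h ▸ rfl))
  · simp only [weight] at hm hn
    have : (m : ℂ) = n := by linear_combination 2 * hm - 2 * hn
    exact_mod_cast this

end NSI

/-- A tensor killed by every `L_m` is supported on pairs whose first entry is `I_0`. -/
theorem apply_eq_zero_of_star2_L (t : NSd.T2)
    (ht : ∀ m : ℤ, NSd.star2 (NSd.e (NSI.L m)) t = 0) {a : NSd.ι} (ha : a ≠ NSI.I 0)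
    (b : NSd.ι) : t (a, b) = 0 := by
  have hfin : (Set.preimage (fun m : ℤ => NSI.shift m a)
      (Set.image Prod.fst (t.support : Set (NSd.ι × NSd.ι)))).Finite :=
    (t.support.finite_toSet.image _).preimage (NSI.shift_left_injective a).injOn
  obtain ⟨m, hm⟩ := (hfin.union (NSI.finite_weight_eq_zero ha)).exists_notMem
  obtain ⟨hm1, hm2⟩ := not_or.1 hm
  let f : NSd.ι ≃ NSd.ι := NSI.shift m
  have h0 : t (f a, f.symm b) = 0 := by
    by_contra hne
    exact hm1 ⟨_, Finsupp.mem_support_iff.2 hne, rfl⟩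
  have h := NSd.star2_e_apply (k := NSI.L m) rfl f (NSI.weight m) (NSI.nsBr_L m) t a b
  rw [ht, h0, mul_zero, add_zero] at h
  exact (mul_eq_zero.1 h.symm).resolve_left hm2

/-- A `τ`-symmetric invariant tensor vanishes. -/
theorem eq_zero_of_tau_eq_of_star2_eq_zero (t : NSd.T2) (hτ : NSd.tau t = t)
    (ht : ∀ k : NSd.ι, NSd.star2 (NSd.e k) t = 0) : t = 0 := by
  let i : NSd.ι := NSI.I 0
  have hsupp : t = Finsupp.single (i, i) (t (i, i)) := by
    classical
    ext ⟨a, b⟩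
    rw [Finsupp.single_apply]
    split_ifs with h
    · rw [← h]
    · by_cases ha : a = i
      · have hb : b ≠ i := fun hb => h (by rw [ha, hb])
        rw [← hτ, SuperData.tau_apply, apply_eq_zero_of_star2_L t (fun m => ht _) hb, mul_zero]
      · exact apply_eq_zero_of_star2_L t (fun m => ht _) ha b
  have hbr : nsBr (NSI.G true 0) (NSI.I 0) = Finsupp.single (NSI.G true 0) (-1) := by
    simp [nsBr]
  have hne : NSI.I 0 ≠ NSI.G true 0 := by simp
  have h := NSd.star2_e_single_diag_apply (k := NSI.G true 0) hne hbr (t (i, i))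
  have h0 : t (i, i) * (-1) = 0 := by
    rw [← h]
    exact (DFunLike.congr_fun (congrArg (NSd.star2 (NSd.e (NSI.G true 0))) hsupp.symm) _).trans
      (DFunLike.congr_fun (ht _) _)
  rw [hsupp, (mul_eq_zero.1 h0).resolve_right (by norm_num), Finsupp.single_zero]

/-- if `x ∗ r ∈ Im(1-τ)` for all `x ∈ L`, then `r ∈ Im(1-τ)`. -/
theorem NS_ImSkew_detection (r : NSd.T2)
    (h : ∀ x : NSd.V, NSd.star2 x r ∈ NSd.ImSkew) : r ∈ NSd.ImSkew := by
  rw [SuperData.mem_ImSkew_iff]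
  refine eq_zero_of_tau_eq_of_star2_eq_zero _ ?_ fun k => ?_
  · rw [map_add, SuperData.tau_tau, add_comm]
  · rw [map_add, ← NSd.tau_star2_e nsBr_homog, ← SuperData.mem_ImSkew_iff]
    exact h _
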